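/- arXiv:2110.13121 — 11 statements merged into one kernel-verified Lean document; each statement's English description precedes it below -/
import Mathlib

section
/- Let N ≥ 3. Then the expectation of the virtual valuation of the second-highest order statistic equals twice the expectation of the third-highest order statistic minus the expectation of the second-highest order statistic; that is, ∫_{x̲}^{x̄} ψ(x)·f₂(x) dx = 2·∫_{x̲}^{x̄} x·f₃(x) dx − ∫_{x̲}^{x̄} x·f₂(x) dx. -/
open MeasureTheory in
/-- The primitive of a function continuous on `[a, b]` has the expected derivative inside. -/
theorem hasDerivAt_of_eq_primitive {a b : ℝ} {F f : ℝ → ℝ}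
    (hf : ContinuousOn f (Set.Icc a b)) (hF : ∀ x ∈ Set.Icc a b, F x = ∫ t in a..x, f t)
    {x : ℝ} (hx : x ∈ Set.Ioo a b) : HasDerivAt F (f x) x := by
  have hnhds : Set.Icc a b ∈ nhds x := Icc_mem_nhds hx.1 hx.2
  have hint : IntervalIntegrable f volume a x :=
    (hf.mono (Set.Icc_subset_Icc_right hx.2.le)).intervalIntegrable_of_Icc hx.1.le
  have hmeas : StronglyMeasurableAtFilter f (nhds x) :=
    (hf.mono Set.Ioo_subset_Icc_self).stronglyMeasurableAtFilter isOpen_Ioo x hx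
  exact (intervalIntegral.integral_hasDerivAt_right hint hmeas
    (hf.continuousAt hnhds)).congr_of_eventuallyEq (Filter.eventually_of_mem hnhds hF)

/-- A primitive of a function continuous on `[a, b]` is continuous on `[a, b]`. -/
theorem continuousOn_of_eq_primitive {a b : ℝ} {F f : ℝ → ℝ} (hab : a ≤ b)
    (hf : ContinuousOn f (Set.Icc a b)) (hF : ∀ x ∈ Set.Icc a b, F x = ∫ t in a..x, f t) :
    ContinuousOn F (Set.Icc a b) := by
  have h := intervalIntegral.continuousOn_primitive_interval (μ := MeasureTheory.volume)
    (f := f) (a := a) (b := b) (by rw [Set.uIcc_of_le hab]; exact hf.integrableOn_Icc)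
  rw [Set.uIcc_of_le hab] at h
  exact h.congr hF

/-- With `N ≥ 3` i.i.d. valuations from a distribution `F` with
continuous positive density `f` on `[xl, xu]`, the expectation of the virtual
valuation of the second-highest order statistic equals twice the expectation of
the third-highest order statistic minus the expectation of the second-highest:
`∫ ψ(x) f₂(x) dx = 2 ∫ x f₃(x) dx − ∫ x f₂(x) dx`. -/
theorem virtual_value_second_order_statistic
    (N : ℕ) (hN : 3 ≤ N)
    (xl xu : ℝ) (hxl : 0 ≤ xl) (hlt : xl < xu)
    (F f : ℝ → ℝ)
    (hf_cont : ContinuousOn f (Set.Icc xl xu))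
    (hf_pos : ∀ x ∈ Set.Icc xl xu, 0 < f x)
    (hF : ∀ x ∈ Set.Icc xl xu, F x = ∫ t in xl..x, f t)
    (hFxu : F xu = 1)
    (ψ : ℝ → ℝ)
    (hψ : ∀ x ∈ Set.Icc xl xu, ψ x = x - (1 - F x) / f x)
    (fk : ℕ → ℝ → ℝ)
    (hfk : ∀ k, 1 ≤ k → k ≤ N → ∀ x ∈ Set.Icc xl xu,
      fk k x = ((Nat.factorial N : ℝ) /
          ((Nat.factorial (k - 1) : ℝ) * (Nat.factorial (N - k) : ℝ)))
        * (1 - F x) ^ (k - 1) * (F x) ^ (N - k) * f x) :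
    (∫ x in xl..xu, ψ x * fk 2 x)
      = 2 * (∫ x in xl..xu, x * fk 3 x) - ∫ x in xl..xu, x * fk 2 x := by
  obtain ⟨n, rfl⟩ : ∃ n, N = n + 3 := ⟨N - 3, by omega⟩
  have hFc := continuousOn_of_eq_primitive hlt.le hf_cont hF
  have hFxl : F xl = 0 := by simp [hF xl (Set.left_mem_Icc.2 hlt.le)]
  set c : ℝ := (n + 3) * (n + 2) with hc
  have hf2 : ∀ x ∈ Set.Icc xl xu, fk 2 x = c * (1 - F x) * F x ^ (n + 1) * f x := by
    intro x hx
    have hn : (n.factorial : ℝ) ≠ 0 := by positivity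
    rw [hfk 2 (by omega) (by omega) x hx, hc, show n + 3 - 2 = n + 1 by omega]
    simp only [Nat.factorial_succ]
    push_cast
    field_simp
    simp
    ring
  have hf3 : ∀ x ∈ Set.Icc xl xu,
      fk 3 x = c * (n + 1) / 2 * (1 - F x) ^ 2 * F x ^ n * f x := by
    intro x hx
    have hn : (n.factorial : ℝ) ≠ 0 := by positivity
    rw [hfk 3 (by omega) (by omega) x hx, hc, show n + 3 - 3 = n by omega]
    simp only [Nat.factorial_succ]
    push_cast
    field_simp
    simp
    ring
  have hcont2 : ContinuousOn (fk 2) (Set.Icc xl xu) :=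
    ContinuousOn.congr (by fun_prop) hf2
  have hcont3 : ContinuousOn (fk 3) (Set.Icc xl xu) :=
    ContinuousOn.congr (by fun_prop) hf3
  have hint2 : IntervalIntegrable (fun x => x * fk 2 x) MeasureTheory.volume xl xu :=
    ContinuousOn.intervalIntegrable_of_Icc hlt.le (by fun_prop)
  have hint3 : IntervalIntegrable (fun x => x * fk 3 x) MeasureTheory.volume xl xu :=
    ContinuousOn.intervalIntegrable_of_Icc hlt.le (by fun_prop)
  have hG : (∫ x in xl..xu, (c * (1 - F x) ^ 2 * F x ^ (n + 1)
      - 2 * (x * fk 2 x) + 2 * (x * fk 3 x))) = 0 := by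
    rw [intervalIntegral.integral_eq_sub_of_hasDerivAt_of_le hlt.le
      (f := fun x => x * (c * (1 - F x) ^ 2 * F x ^ (n + 1)))]
    · simp [hFxu, hFxl]
    · fun_prop
    · intro x hx
      have hFd := hasDerivAt_of_eq_primitive hf_cont hF hx
      have hx' := Set.Ioo_subset_Icc_self hx
      refine ((hasDerivAt_id x).mul
        ((((hFd.const_sub 1).pow 2).const_mul c).mul (hFd.pow (n + 1)))).congr_deriv ?_
      rw [hf2 x hx', hf3 x hx']
      simp
      ring
    · exact ContinuousOn.intervalIntegrable_of_Icc hlt.le (by fun_prop)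
  have hψf : (∫ x in xl..xu, ψ x * fk 2 x)
      = ∫ x in xl..xu, (2 * (x * fk 3 x) - x * fk 2 x
        - (c * (1 - F x) ^ 2 * F x ^ (n + 1) - 2 * (x * fk 2 x) + 2 * (x * fk 3 x))) := by
    refine intervalIntegral.integral_congr fun x hx => ?_
    rw [Set.uIcc_of_le hlt.le] at hx
    have hfx := (hf_pos x hx).ne'
    simp only [hψ x hx, hf2 x hx]
    field_simp
    ring
  rw [hψf, intervalIntegral.integral_sub ((hint3.const_mul 2).sub hint2)
    (ContinuousOn.intervalIntegrable_of_Icc hlt.le (by fun_prop)), hG, sub_zero,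
    intervalIntegral.integral_sub (hint3.const_mul 2) hint2,
    intervalIntegral.integral_const_mul]
end

section
/- Let N ≥ 2. Then the expectation of the virtual valuation of the highest order statistic equals the expectation of the second-highest order statistic; that is, ∫_{x̲}^{x̄} ψ(x)·f₁(x) dx = ∫_{x̲}^{x̄} x·f₂(x) dx. -/
/-- With `N ≥ 2` i.i.d. valuations from a distribution `F` with
continuous positive density `f` on `[xl, xu]`, the expectation of the virtual
valuation of the highest order statistic equals the expectation of the
second-highest order statistic: `∫ ψ(x) f₁(x) dx = ∫ x f₂(x) dx`. -/
theorem virtual_value_first_order_statistic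
    (N : ℕ) (hN : 2 ≤ N)
    (xl xu : ℝ) (hxl : 0 ≤ xl) (hlt : xl < xu)
    (F f : ℝ → ℝ)
    (hf_cont : ContinuousOn f (Set.Icc xl xu))
    (hf_pos : ∀ x ∈ Set.Icc xl xu, 0 < f x)
    (hF : ∀ x ∈ Set.Icc xl xu, F x = ∫ t in xl..x, f t)
    (hFxu : F xu = 1)
    (ψ : ℝ → ℝ)
    (hψ : ∀ x ∈ Set.Icc xl xu, ψ x = x - (1 - F x) / f x)
    (fk : ℕ → ℝ → ℝ)
    (hfk : ∀ k, 1 ≤ k → k ≤ N → ∀ x ∈ Set.Icc xl xu,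
      fk k x = ((Nat.factorial N : ℝ) /
          ((Nat.factorial (k - 1) : ℝ) * (Nat.factorial (N - k) : ℝ)))
        * (1 - F x) ^ (k - 1) * (F x) ^ (N - k) * f x) :
    (∫ x in xl..xu, ψ x * fk 1 x) = ∫ x in xl..xu, x * fk 2 x := by
  obtain ⟨m, rfl⟩ : ∃ m, N = m + 2 := ⟨N - 2, by omega⟩
  have hle := hlt.le
  have hfi : ∀ x ∈ Set.Icc xl xu, IntervalIntegrable f MeasureTheory.volume xl x := fun x hx =>
    (hf_cont.mono (Set.Icc_subset_Icc_right hx.2)).intervalIntegrable_of_Icc hx.1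
  have hFxl : F xl = 0 := by
    rw [hF xl (Set.left_mem_Icc.2 hle), intervalIntegral.integral_same]
  have hF_cont : ContinuousOn F (Set.Icc xl xu) := by
    have h := intervalIntegral.continuousOn_primitive_interval (a := xl) (b := xu)
      (μ := MeasureTheory.volume) (f := f)
      (by rw [Set.uIcc_of_le hle]; exact hf_cont.integrableOn_Icc)
    rw [Set.uIcc_of_le hle] at h
    exact h.congr hF
  have hF_deriv : ∀ x ∈ Set.Ioo xl xu, HasDerivAt F (f x) x := by
    intro x hx
    have hnhds : Set.Icc xl xu ∈ nhds x := Icc_mem_nhds hx.1 hx.2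
    refine (intervalIntegral.integral_hasDerivAt_right (hfi x (Set.Ioo_subset_Icc_self hx))
      ((hf_cont.mono Set.Ioo_subset_Icc_self).stronglyMeasurableAtFilter isOpen_Ioo x hx)
      (hf_cont.continuousAt hnhds)).congr_of_eventuallyEq ?_
    filter_upwards [hnhds] with y hy using hF y hy
  have hfact : ((m + 2).factorial : ℝ) = (m + 2) * ((m + 1) * m.factorial) := by
    rw [Nat.factorial_succ, Nat.factorial_succ]; push_cast; ring
  have hfact' : ((m + 1).factorial : ℝ) = (m + 1) * m.factorial := by
    rw [Nat.factorial_succ]; push_cast; ring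
  have hm : (m.factorial : ℝ) ≠ 0 := by positivity
  have hm' : (m + 1 : ℝ) ≠ 0 := by positivity
  have hfirst : Set.EqOn (fun x => ψ x * fk 1 x)
      (fun x => (m + 2) * F x ^ (m + 1) * (x * f x - (1 - F x))) (Set.uIcc xl xu) := by
    intro x hx
    rw [Set.uIcc_of_le hle] at hx
    have hfx := (hf_pos x hx).ne'
    have hsub : m + 2 - 1 = m + 1 := by omega
    simp only [hψ x hx, hfk 1 le_rfl (by omega) x hx, hsub, hfact, hfact', Nat.sub_self,
      Nat.factorial_zero, Nat.cast_one, pow_zero]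
    field_simp
  have hsecond : Set.EqOn (fun x => x * fk 2 x)
      (fun x => (m + 2) * (m + 1) * x * (1 - F x) * F x ^ m * f x) (Set.uIcc xl xu) := by
    intro x hx
    rw [Set.uIcc_of_le hle] at hx
    simp only [hfk 2 (by omega) (by omega) x hx, Nat.add_sub_cancel, hfact,
      Nat.reduceSub, Nat.factorial_one, Nat.cast_one, pow_one]
    field_simp
  have hint₁ : IntervalIntegrable (fun x => (m + 2) * F x ^ (m + 1) * (x * f x - (1 - F x)))
      MeasureTheory.volume xl xu :=
    ContinuousOn.intervalIntegrable_of_Icc hle (by fun_prop)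
  have hint₂ : IntervalIntegrable (fun x => (m + 2) * (m + 1) * x * (1 - F x) * F x ^ m * f x)
      MeasureTheory.volume xl xu :=
    ContinuousOn.intervalIntegrable_of_Icc hle (by fun_prop)
  rw [intervalIntegral.integral_congr hfirst, intervalIntegral.integral_congr hsecond,
    ← sub_eq_zero, ← intervalIntegral.integral_sub hint₁ hint₂,
    intervalIntegral.integral_eq_sub_of_hasDerivAt_of_le hle
      (f := fun x => -((m + 2) * (x * ((1 - F x) * F x ^ (m + 1))))) (by fun_prop) ?_
      (hint₁.sub hint₂)]
  · simp [hFxl, hFxu]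
  · intro x hx
    have hd := hF_deriv x hx
    refine (((hasDerivAt_id x).mul ((hd.const_sub 1).mul (hd.pow (m + 1)))).const_mul
      (m + 2 : ℝ)).neg.congr_deriv ?_
    simp only [id, Pi.mul_apply, Pi.pow_apply, Nat.add_sub_cancel]
    push_cast
    ring
end

section
/- Let N ≥ 3. Then the expected revenue of the optimal must-sell mechanism equals the expectation of the third-highest valuation: E[ψ(X_(2)) + X_(2) − X_(3)] = E[X_(3)], i.e., ∫_{x̲}^{x̄} ψ(x)·f₂(x) dx + ∫_{x̲}^{x̄} x·f₂(x) dx − ∫_{x̲}^{x̄} x·f₃(x) dx = ∫_{x̲}^{x̄} x·f₃(x) dx. -/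
open Set intervalIntegral in
/-- Integration by parts for `x * (1 - F x) ^ 2 * F x ^ (m + 1)`, whose boundary terms vanish when
`F` rises from `0` to `1`. -/
theorem integral_deriv_mul_one_sub_sq_mul_pow_eq_zero (m : ℕ) {a b : ℝ} (hab : a ≤ b) {F f : ℝ → ℝ}
    (hF : ContinuousOn F (Icc a b)) (hf : ContinuousOn f (Icc a b))
    (hderiv : ∀ x ∈ Ioo a b, HasDerivAt F (f x) x) (hFa : F a = 0) (hFb : F b = 1) :
    ∫ x in a..b, ((1 - F x) ^ 2 * F x ^ (m + 1) - 2 * x * (1 - F x) * F x ^ (m + 1) * f x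
      + (m + 1) * x * (1 - F x) ^ 2 * F x ^ m * f x) = 0 := by
  rw [integral_eq_sub_of_hasDerivAt_of_le hab
    (f := fun x => x * (1 - F x) ^ 2 * F x ^ (m + 1)) (by fun_prop) ?_ ?_]
  · simp [hFa, hFb]
  · intro x hx
    have h := hderiv x hx
    refine (((hasDerivAt_id x).mul ((h.const_sub 1).pow 2)).mul (h.pow (m + 1))).congr_deriv ?_
    simp
    ring
  · exact ContinuousOn.intervalIntegrable_of_Icc hab (by fun_prop)

open Set MeasureTheory intervalIntegral in
/-- The primitive of a function continuous on `[a, b]` is differentiable inside the interval. -/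
theorem hasDerivAt_of_eq_integral_Icc {a b : ℝ} {F f : ℝ → ℝ} (hf : ContinuousOn f (Icc a b))
    (hF : ∀ x ∈ Icc a b, F x = ∫ t in a..x, f t) {x : ℝ} (hx : x ∈ Ioo a b) :
    HasDerivAt F (f x) x := by
  have hnhds : Icc a b ∈ nhds x := Icc_mem_nhds hx.1 hx.2
  have hint : IntervalIntegrable f volume a x :=
    (hf.mono (Icc_subset_Icc_right hx.2.le)).intervalIntegrable_of_Icc hx.1.le
  have hmeas : StronglyMeasurableAtFilter f (nhds x) :=
    ⟨Icc a b, hnhds, hf.aestronglyMeasurable measurableSet_Icc⟩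
  exact (integral_hasDerivAt_right hint hmeas (hf.continuousAt hnhds)).congr_of_eventuallyEq
    (Filter.eventually_of_mem hnhds hF)

/-- With `N ≥ 3` i.i.d. valuations, the expected revenue of the
optimal must-sell mechanism equals the expectation of the third-highest
valuation: `E[ψ(X₍₂₎) + X₍₂₎ − X₍₃₎] = E[X₍₃₎]`. -/
theorem must_sell_revenue_eq_third_order_statistic
    (N : ℕ) (hN : 3 ≤ N)
    (xl xu : ℝ) (hxl : 0 ≤ xl) (hlt : xl < xu)
    (F f : ℝ → ℝ)
    (hf_cont : ContinuousOn f (Set.Icc xl xu))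
    (hf_pos : ∀ x ∈ Set.Icc xl xu, 0 < f x)
    (hF : ∀ x ∈ Set.Icc xl xu, F x = ∫ t in xl..x, f t)
    (hFxu : F xu = 1)
    (ψ : ℝ → ℝ)
    (hψ : ∀ x ∈ Set.Icc xl xu, ψ x = x - (1 - F x) / f x)
    (fk : ℕ → ℝ → ℝ)
    (hfk : ∀ k, 1 ≤ k → k ≤ N → ∀ x ∈ Set.Icc xl xu,
      fk k x = ((Nat.factorial N : ℝ) /
          ((Nat.factorial (k - 1) : ℝ) * (Nat.factorial (N - k) : ℝ)))
        * (1 - F x) ^ (k - 1) * (F x) ^ (N - k) * f x) :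
    (∫ x in xl..xu, ψ x * fk 2 x) + (∫ x in xl..xu, x * fk 2 x)
        - (∫ x in xl..xu, x * fk 3 x)
      = ∫ x in xl..xu, x * fk 3 x := by
  obtain ⟨m, rfl⟩ := Nat.exists_eq_add_of_le' hN
  have hle := hlt.le
  have hF_cont : ContinuousOn F (Set.Icc xl xu) :=
    (intervalIntegral.continuousOn_primitive_interval'
      (hf_cont.intervalIntegrable_of_Icc hle) Set.left_mem_uIcc).congr_mono
      hF (Set.uIcc_of_le hle).ge
  have hFxl : F xl = 0 := by simp [hF xl (Set.left_mem_Icc.2 hle)]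
  have hf_ne : ∀ x ∈ Set.Icc xl xu, f x ≠ 0 := fun x hx => (hf_pos x hx).ne'
  have hfact : ((m + 3).factorial : ℝ) = (m + 3) * (m + 2) * (m + 1) * m.factorial := by
    simp only [Nat.factorial_succ]
    push_cast
    ring
  have hm : (m.factorial : ℝ) ≠ 0 := mod_cast m.factorial_ne_zero
  have hm1 : (m + 1 : ℝ) ≠ 0 := by positivity
  have hfk2 : ∀ x ∈ Set.Icc xl xu,
      fk 2 x = (m + 3) * (m + 2) * (1 - F x) * F x ^ (m + 1) * f x := by
    intro x hx
    rw [hfk 2 (by lia) (by lia) x hx, hfact, show m + 3 - 2 = m + 1 by lia, Nat.factorial_succ m]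
    simp only [Nat.add_one_sub_one, Nat.factorial_one, Nat.cast_one, pow_one, one_mul]
    push_cast
    field_simp
  have hfk3 : ∀ x ∈ Set.Icc xl xu,
      fk 3 x = (m + 3) * (m + 2) * (m + 1) / 2 * (1 - F x) ^ 2 * F x ^ m * f x := by
    intro x hx
    rw [hfk 3 (by lia) (by lia) x hx, hfact, Nat.add_sub_cancel]
    simp only [Nat.add_one_sub_one, Nat.factorial_two, Nat.cast_ofNat]
    field_simp
  have hfk2_cont : ContinuousOn (fk 2) (Set.Icc xl xu) := ContinuousOn.congr (by fun_prop) hfk2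
  have hfk3_cont : ContinuousOn (fk 3) (Set.Icc xl xu) := ContinuousOn.congr (by fun_prop) hfk3
  have hψ_cont : ContinuousOn ψ (Set.Icc xl xu) :=
    ContinuousOn.congr (by fun_prop (disch := assumption)) hψ
  have hi1 : IntervalIntegrable (fun x => ψ x * fk 2 x) MeasureTheory.volume xl xu :=
    (hψ_cont.mul hfk2_cont).intervalIntegrable_of_Icc hle
  have hi2 : IntervalIntegrable (fun x => x * fk 2 x) MeasureTheory.volume xl xu :=
    (continuousOn_id.mul hfk2_cont).intervalIntegrable_of_Icc hle
  have hi3 : IntervalIntegrable (fun x => x * fk 3 x) MeasureTheory.volume xl xu :=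
    (continuousOn_id.mul hfk3_cont).intervalIntegrable_of_Icc hle
  rw [← sub_eq_zero, ← intervalIntegral.integral_add hi1 hi2,
    ← intervalIntegral.integral_sub (hi1.add hi2) hi3,
    ← intervalIntegral.integral_sub ((hi1.add hi2).sub hi3) hi3]
  have key := integral_deriv_mul_one_sub_sq_mul_pow_eq_zero m hle hF_cont hf_cont
    (fun x hx => hasDerivAt_of_eq_integral_Icc hf_cont hF hx) hFxl hFxu
  rw [← mul_zero (-((m + 3) * (m + 2) : ℝ)), ← key, ← intervalIntegral.integral_const_mul]
  refine intervalIntegral.integral_congr fun x hx => ?_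
  rw [Set.uIcc_of_le hle] at hx
  have := hf_ne x hx
  simp only [hψ x hx, hfk2 x hx, hfk3 x hx]
  field_simp
  ring
end

section
/- Let N ≥ 3 and let f_{2,3}(y,z) = N·(N−1)·(N−2)·(1−F(y))·f(y)·F(z)^{N−3}·f(z) for x̲ ≤ z ≤ y ≤ x̄ be the joint density of the second- and third-highest order statistics. Then the expected revenue of the optimal mechanism weakly exceeds the expected revenue of the must-sell mechanism: ∫_{x̲}^{x̄} ∫_{x̲}^{y} max{ψ(y) + y − z, 0}·f_{2,3}(y,z) dz dy ≥ ∫_{x̲}^{x̄} x·f₃(x) dx. Moreover, if ψ is continuous and ψ(x̲) < 0, then the inequality is strict. -/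
open intervalIntegral Set

/-- Reduction of the double integral of the unconstrained virtual surplus to the expectation of the
third-highest order statistic, by integrating the exact derivative of
`-y (1 - F y)² K y + (1 - F y)² / 2 * M y`. -/
lemma integral_virtual_surplus_eq {a b c : ℝ} {n : ℕ} {F f : ℝ → ℝ}
    (hf : Continuous f) (hpos : ∀ x, 0 < f x) (hF : ∀ x, HasDerivAt F (f x) x) (hFb : F b = 1) :
    ∫ y in a..b, ∫ z in a..y,
        (y - (1 - F y) / f y + y - z) * (c * (1 - F y) * f y * F z ^ n * f z)
      = ∫ x in a..b, x * (c / 2 * (1 - F x) ^ 2 * F x ^ n * f x) := by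
  have hFc : Continuous F := continuous_iff_continuousAt.2 fun x => (hF x).continuousAt
  have hk : Continuous fun z => F z ^ n * f z := by fun_prop
  have hm : Continuous fun z => z * (F z ^ n * f z) := by fun_prop
  set K : ℝ → ℝ := fun y => ∫ z in a..y, F z ^ n * f z with hK
  set M : ℝ → ℝ := fun y => ∫ z in a..y, z * (F z ^ n * f z) with hM
  have hKd : ∀ y, HasDerivAt K (F y ^ n * f y) y := fun y => hk.integral_hasStrictDerivAt a y
    |>.hasDerivAt
  have hMd : ∀ y, HasDerivAt M (y * (F y ^ n * f y)) y := fun y =>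
    hm.integral_hasStrictDerivAt a y |>.hasDerivAt
  have hKc : Continuous K := continuous_iff_continuousAt.2 fun x => (hKd x).continuousAt
  have hMc : Continuous M := continuous_iff_continuousAt.2 fun x => (hMd x).continuousAt
  have inner : ∀ y, ∫ z in a..y,
      (y - (1 - F y) / f y + y - z) * (c * (1 - F y) * f y * F z ^ n * f z)
      = c * ((2 * y * (1 - F y) * f y - (1 - F y) ^ 2) * K y - (1 - F y) * f y * M y) := by
    intro y
    have h : ∀ z, (y - (1 - F y) / f y + y - z) * (c * (1 - F y) * f y * F z ^ n * f z)
        = c * (2 * y * (1 - F y) * f y - (1 - F y) ^ 2) * (F z ^ n * f z)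
          - c * (1 - F y) * f y * (z * (F z ^ n * f z)) := by
      intro z
      have := (hpos y).ne'
      field_simp
      ring
    simp_rw [h]
    rw [integral_sub ((hk.intervalIntegrable _ _).const_mul _)
      ((hm.intervalIntegrable _ _).const_mul _), integral_const_mul, integral_const_mul]
    ring
  simp_rw [inner]
  rw [← sub_eq_zero, ← integral_sub (Continuous.intervalIntegrable (by fun_prop) _ _)
    (Continuous.intervalIntegrable (by fun_prop) _ _)]
  have hΦ : ∀ y, HasDerivAt
      (fun y => c * (-(y * (1 - F y) ^ 2) * K y + (1 - F y) ^ 2 / 2 * M y))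
      (c * ((2 * y * (1 - F y) * f y - (1 - F y) ^ 2) * K y - (1 - F y) * f y * M y)
        - y * (c / 2 * (1 - F y) ^ 2 * F y ^ n * f y)) y := by
    intro y
    have hG := ((hF y).const_sub 1).pow 2
    have := ((((hasDerivAt_id y).mul hG).neg.mul (hKd y)).add
      ((hG.div_const 2).mul (hMd y))).const_mul c
    refine this.congr_deriv ?_
    simp only [Pi.pow_apply, Pi.mul_apply, Pi.neg_apply, id_eq]
    push_cast
    ring
  rw [integral_eq_sub_of_hasDerivAt (fun y _ => hΦ y)
    (Continuous.intervalIntegrable (by fun_prop) _ _)]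
  simp [hK, hM, hFb]

lemma revenue_ge_of_continuous {a b c : ℝ} {n : ℕ} {F f : ℝ → ℝ} (hab : a < b) (hc : 0 < c)
    (hf : Continuous f) (hpos : ∀ x, 0 < f x) (hF : ∀ x, HasDerivAt F (f x) x)
    (hFa : F a = 0) (hFb : F b = 1) :
    (∫ x in a..b, x * (c / 2 * (1 - F x) ^ 2 * F x ^ n * f x)) ≤
        ∫ y in a..b, ∫ z in a..y,
          max (y - (1 - F y) / f y + y - z) 0 * (c * (1 - F y) * f y * F z ^ n * f z)
    ∧ (a - (1 - F a) / f a < 0 →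
      (∫ x in a..b, x * (c / 2 * (1 - F x) ^ 2 * F x ^ n * f x)) <
        ∫ y in a..b, ∫ z in a..y,
          max (y - (1 - F y) / f y + y - z) 0 * (c * (1 - F y) * f y * F z ^ n * f z)) := by
  have hFc : Continuous F := continuous_iff_continuousAt.2 fun x => (hF x).continuousAt
  have hmono : StrictMono F := strictMono_of_hasDerivAt_pos hF hpos
  have hf0 : ∀ x, f x ≠ 0 := fun x => (hpos x).ne'
  have hw : ∀ y ≤ b, ∀ z, a ≤ z → 0 ≤ c * (1 - F y) * f y * F z ^ n * f z := by
    intro y hy z hz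
    have h1 : 0 ≤ 1 - F y := by linarith [hmono.monotone hy]
    have h2 : 0 ≤ F z := by linarith [hmono.monotone hz]
    have := hpos y
    have := hpos z
    positivity
  have hL : Continuous (Function.uncurry fun y z : ℝ =>
      (y - (1 - F y) / f y + y - z) * (c * (1 - F y) * f y * F z ^ n * f z)) := by
    unfold Function.uncurry
    fun_prop (disch := simp [hf0])
  have hR : Continuous (Function.uncurry fun y z : ℝ =>
      max (y - (1 - F y) / f y + y - z) 0 * (c * (1 - F y) * f y * F z ^ n * f z)) := by
    unfold Function.uncurry
    fun_prop (disch := simp [hf0])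
  have hLi := continuous_parametric_intervalIntegral_of_continuous (μ := MeasureTheory.volume)
    (a₀ := a) hL continuous_id
  have hRi := continuous_parametric_intervalIntegral_of_continuous (μ := MeasureTheory.volume)
    (a₀ := a) hR continuous_id
  simp only [id_eq] at hLi hRi
  have hle : ∀ y ∈ Icc a b, ∀ z ∈ Icc a y,
      (y - (1 - F y) / f y + y - z) * (c * (1 - F y) * f y * F z ^ n * f z) ≤
      max (y - (1 - F y) / f y + y - z) 0 * (c * (1 - F y) * f y * F z ^ n * f z) :=
    fun y hy z hz => mul_le_mul_of_nonneg_right (le_max_left _ _) (hw y hy.2 z hz.1)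
  have hLy : ∀ y, Continuous _ := fun y => hL.comp (Continuous.prodMk_right y)
  have hRy : ∀ y, Continuous _ := fun y => hR.comp (Continuous.prodMk_right y)
  have hinner : ∀ y ∈ Icc a b, (∫ z in a..y,
        (y - (1 - F y) / f y + y - z) * (c * (1 - F y) * f y * F z ^ n * f z)) ≤ ∫ z in a..y,
        max (y - (1 - F y) / f y + y - z) 0 * (c * (1 - F y) * f y * F z ^ n * f z) :=
    fun y hy => integral_mono_on hy.1 ((hLy y).intervalIntegrable _ _)
      ((hRy y).intervalIntegrable _ _) (hle y hy)
  rw [← integral_virtual_surplus_eq hf hpos hF hFb]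
  refine ⟨integral_mono_on hab.le (hLi.intervalIntegrable _ _) (hRi.intervalIntegrable _ _) hinner,
    fun hneg => ?_⟩
  obtain ⟨y, hyneg, hya, hyb⟩ : ∃ y, y - (1 - F y) / f y + y - a < 0 ∧ a < y ∧ y < b := by
    have hcont : Continuous fun y => y - (1 - F y) / f y + y - a := by
      fun_prop (disch := simp [hf0])
    have h1 : ∀ᶠ y in nhds a, y - (1 - F y) / f y + y - a < 0 :=
      hcont.continuousAt.eventually_lt_const (by simpa using hneg)
    exact ((h1.filter_mono nhdsWithin_le_nhds).and
      (Ioo_mem_nhdsGT hab)).exists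
  refine integral_lt_integral_of_continuousOn_of_le_of_exists_lt hab hLi.continuousOn
    hRi.continuousOn (fun y hy => hinner y ⟨hy.1.le, hy.2⟩) ⟨y, ⟨hya.le, hyb.le⟩, ?_⟩
  refine integral_lt_integral_of_continuousOn_of_le_of_exists_lt hya (hLy y).continuousOn
    (hRy y).continuousOn (fun z hz => hle y ⟨hya.le, hyb.le⟩ z ⟨hz.1.le, hz.2⟩)
    ⟨y, ⟨hya.le, le_rfl⟩, ?_⟩
  have h1 : 0 < 1 - F y := by linarith [hmono hyb]
  have h2 : 0 < F y := by linarith [hmono hya]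
  have := hpos y
  exact mul_lt_mul_of_pos_right (lt_max_of_lt_right (by linarith)) (by positivity)


/-- With `N ≥ 3` i.i.d. valuations and joint density
`f₂₃(y,z) = N(N−1)(N−2)(1−F(y))f(y)F(z)^{N−3}f(z)` of the second- and
third-highest order statistics, the expected revenue of the optimal mechanism
weakly exceeds that of the must-sell mechanism (the expectation of the
third-highest valuation); moreover if `ψ` is continuous and `ψ(x̲) < 0` then
the inequality is strict. -/
theorem optimal_revenue_ge_must_sell
    (N : ℕ) (hN : 3 ≤ N)
    (xl xu : ℝ) (hxl : 0 ≤ xl) (hlt : xl < xu)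
    (F f : ℝ → ℝ)
    (hf_cont : ContinuousOn f (Set.Icc xl xu))
    (hf_pos : ∀ x ∈ Set.Icc xl xu, 0 < f x)
    (hF : ∀ x ∈ Set.Icc xl xu, F x = ∫ t in xl..x, f t)
    (hFxu : F xu = 1)
    (ψ : ℝ → ℝ)
    (hψ : ∀ x ∈ Set.Icc xl xu, ψ x = x - (1 - F x) / f x)
    (f23 : ℝ → ℝ → ℝ)
    (hf23 : ∀ y ∈ Set.Icc xl xu, ∀ z ∈ Set.Icc xl y,
      f23 y z = (N : ℝ) * ((N : ℝ) - 1) * ((N : ℝ) - 2)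
        * (1 - F y) * f y * (F z) ^ (N - 3) * f z)
    (f3 : ℝ → ℝ)
    (hf3 : ∀ x ∈ Set.Icc xl xu,
      f3 x = ((Nat.factorial N : ℝ) /
          ((Nat.factorial 2 : ℝ) * (Nat.factorial (N - 3) : ℝ)))
        * (1 - F x) ^ 2 * (F x) ^ (N - 3) * f x) :
    (∫ y in xl..xu, ∫ z in xl..y, max (ψ y + y - z) 0 * f23 y z)
        ≥ (∫ x in xl..xu, x * f3 x)
    ∧ (ContinuousOn ψ (Set.Icc xl xu) → ψ xl < 0 →
        (∫ y in xl..xu, ∫ z in xl..y, max (ψ y + y - z) 0 * f23 y z)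
          > (∫ x in xl..xu, x * f3 x)) := by
  obtain ⟨n, rfl⟩ := Nat.exists_eq_add_of_le' hN
  set g : ℝ → ℝ := IccExtend hlt.le ((Icc xl xu).domRestrict f) with hg_def
  have hg : Continuous g := hf_cont.domRestrict.Icc_extend'
  have hgf : ∀ x ∈ Icc xl xu, g x = f x := fun x hx => IccExtend_of_mem hlt.le _ hx
  have hgpos : ∀ x, 0 < g x := fun x => hf_pos _ (projIcc xl xu hlt.le x).2
  set G : ℝ → ℝ := fun x => ∫ t in xl..x, g t with hG_def
  have hGd : ∀ x, HasDerivAt G (g x) x := fun x =>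
    (hg.integral_hasStrictDerivAt xl x).hasDerivAt
  have hGF : ∀ x ∈ Icc xl xu, G x = F x := by
    intro x hx
    rw [hF x hx]
    refine integral_congr fun t ht => ?_
    rw [uIcc_of_le hx.1] at ht
    exact hgf t ⟨ht.1, ht.2.trans hx.2⟩
  have hxl_mem : xl ∈ Icc xl xu := left_mem_Icc.2 hlt.le
  have hGa : G xl = 0 := integral_same
  have hGb : G xu = 1 := (hGF xu (right_mem_Icc.2 hlt.le)).trans hFxu
  have hc : (0 : ℝ) < ((n : ℝ) + 3) * ((n : ℝ) + 2) * ((n : ℝ) + 1) := by positivity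
  have hfact : (Nat.factorial (n + 3) : ℝ) / ((Nat.factorial 2 : ℝ) * (Nat.factorial n : ℝ))
      = ((n : ℝ) + 3) * ((n : ℝ) + 2) * ((n : ℝ) + 1) / 2 := by
    have : (Nat.factorial n : ℝ) ≠ 0 := by positivity
    simp only [Nat.factorial_succ, Nat.cast_mul]
    push_cast
    field_simp
    ring
  have key := revenue_ge_of_continuous (n := n) hlt hc hg hgpos hGd hGa hGb
  have hmust : ∫ x in xl..xu, x * f3 x = ∫ x in xl..xu, x *
      (((n : ℝ) + 3) * ((n : ℝ) + 2) * ((n : ℝ) + 1) / 2 * (1 - G x) ^ 2 * G x ^ n * g x) := by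
    refine integral_congr fun x hx => ?_
    rw [uIcc_of_le hlt.le] at hx
    simp only [hf3 x hx, hGF x hx, hgf x hx, Nat.add_sub_cancel, hfact]
  have hopt : (∫ y in xl..xu, ∫ z in xl..y, max (ψ y + y - z) 0 * f23 y z) =
      ∫ y in xl..xu, ∫ z in xl..y, max (y - (1 - G y) / g y + y - z) 0 *
        (((n : ℝ) + 3) * ((n : ℝ) + 2) * ((n : ℝ) + 1) * (1 - G y) * g y * G z ^ n * g z) := by
    refine integral_congr fun y hy => ?_
    rw [uIcc_of_le hlt.le] at hy
    refine integral_congr fun z hz => ?_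
    rw [uIcc_of_le hy.1] at hz
    have hz' : z ∈ Icc xl xu := ⟨hz.1, hz.2.trans hy.2⟩
    simp only [hf23 y hy z hz, hψ y hy, hGF y hy, hgf y hy, hGF z hz', hgf z hz',
      Nat.add_sub_cancel]
    push_cast
    ring
  rw [hmust, hopt]
  refine ⟨key.1, fun _ hneg => key.2 ?_⟩
  rwa [hψ xl hxl_mem, ← hGF xl hxl_mem, ← hgf xl hxl_mem] at hneg
end

section
/- The function z^r is strictly increasing on [r, a(r)] and constant on [a(r), x̄]; moreover Z^r(x̄) = 0, the function Z^r is quasiconvex on [r, x̄], and consequently Z^r(x*) ≤ max{Z^r(r), 0} for every x* ∈ [r, x̄]. -/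
/-- A function which is, up to sign, the tail integral of a monotone function against a nonnegative
weight is quasiconvex. -/
theorem quasiconvexOn_of_eq_neg_integral_monotoneOn {a b : ℝ} {Z z f : ℝ → ℝ}
    (hz : MonotoneOn z (Set.Icc a b)) (hf : ∀ x ∈ Set.Icc a b, 0 ≤ f x)
    (hint : IntervalIntegrable (fun x => z x * f x) MeasureTheory.volume a b)
    (hZ : ∀ x ∈ Set.Icc a b, Z x = -∫ t in x..b, z t * f t) :
    QuasiconvexOn ℝ (Set.Icc a b) Z := by
  have hsub : ∀ x ∈ Set.Icc a b, ∀ y ∈ Set.Icc a b,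
      IntervalIntegrable (fun x => z x * f x) MeasureTheory.volume x y := fun x hx y hy =>
    hint.mono_set ((Set.uIcc_subset_Icc hx hy).trans Set.Icc_subset_uIcc)
  have hdiff : ∀ x ∈ Set.Icc a b, ∀ y ∈ Set.Icc a b, Z y - Z x = ∫ t in x..y, z t * f t := by
    intro x hx y hy
    have hb : b ∈ Set.Icc a b := ⟨hx.1.trans hx.2, le_rfl⟩
    rw [hZ x hx, hZ y hy,
      ← intervalIntegral.integral_add_adjacent_intervals (hsub x hx y hy) (hsub y hy b hb)]
    ring
  intro c
  refine Set.OrdConnected.convex ⟨?_⟩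
  rintro x ⟨hx, hxc⟩ w ⟨hw, hwc⟩ y hy
  have hyI : y ∈ Set.Icc a b := ⟨hx.1.trans hy.1, hy.2.trans hw.2⟩
  refine ⟨hyI, ?_⟩
  rcases le_total (z y) 0 with h | h
  · have h1 : 0 ≤ ∫ t in x..y, -(z t * f t) := by
      refine intervalIntegral.integral_nonneg hy.1 fun t ht => ?_
      have htI : t ∈ Set.Icc a b := ⟨hx.1.trans ht.1, ht.2.trans hyI.2⟩
      have := hz htI hyI ht.2
      nlinarith [hf t htI]
    rw [intervalIntegral.integral_neg, ← hdiff x hx y hyI] at h1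
    linarith
  · have h1 : 0 ≤ ∫ t in y..w, z t * f t := by
      refine intervalIntegral.integral_nonneg hy.2 fun t ht => ?_
      have htI : t ∈ Set.Icc a b := ⟨hyI.1.trans ht.1, ht.2.trans hw.2⟩
      exact mul_nonneg (h.trans (hz hyI htI ht.1)) (hf t htI)
    rw [← hdiff y hyI w hw] at h1
    linarith

/-- The function `z^r` is strictly increasing on `[r, a(r)]`
and constant on `[a(r), x̄]`; moreover `Z^r(x̄) = 0`, `Z^r` is quasiconvex on
`[r, x̄]`, and consequently `Z^r(x*) ≤ max {Z^r(r), 0}` for every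
`x* ∈ [r, x̄]`. -/
theorem z_monotonicity_and_Z_quasiconvex
    (N : ℕ) (hN : 3 ≤ N)
    (xl xu : ℝ) (hxl : 0 ≤ xl) (hlt : xl < xu)
    (F f : ℝ → ℝ)
    (hf_cont : ContinuousOn f (Set.Icc xl xu))
    (hf_pos : ∀ x ∈ Set.Icc xl xu, 0 < f x)
    (hF : ∀ x ∈ Set.Icc xl xu, F x = ∫ t in xl..x, f t)
    (hFxu : F xu = 1)
    (ψ : ℝ → ℝ)
    (hψ : ∀ x ∈ Set.Icc xl xu, ψ x = x - (1 - F x) / f x)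
    (hψc : ContinuousOn ψ (Set.Icc xl xu))
    (hψm : StrictMonoOn ψ (Set.Icc xl xu))
    (hψxu : 0 ≤ ψ xu)
    (r : ℝ) (hr : r ∈ Set.Ico xl xu) (hψr : ψ r < 0)
    (ar : ℝ) (har : ar ∈ Set.Ioc r xu) (har2 : ar + ψ ar = r)
    (Z z : ℝ → ℝ)
    (hZ : ∀ xs : ℝ, Z xs = r * F r * (1 - F xs)
      + ((N : ℝ) - 1) *
        ∫ x in xs..xu, (∫ x' in r..(min x ar), (ψ x' + x' - r) * f x') * f x)
    (hz : ∀ xs : ℝ, z xs = -(r * F r)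
      + ((N : ℝ) - 1) * ∫ x' in r..(min xs ar), (r - x' - ψ x') * f x') :
    StrictMonoOn z (Set.Icc r ar)
    ∧ (∀ x ∈ Set.Icc ar xu, z x = z ar)
    ∧ Z xu = 0
    ∧ QuasiconvexOn ℝ (Set.Icc r xu) Z
    ∧ (∀ xs ∈ Set.Icc r xu, Z xs ≤ max (Z r) 0) := by
  obtain ⟨hr1, hr2⟩ := hr
  obtain ⟨har0, har1⟩ := har
  have hN1 : (0 : ℝ) < (N : ℝ) - 1 := by
    have : (3 : ℝ) ≤ N := by exact_mod_cast hN
    linarith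
  have hsub : Set.Icc r xu ⊆ Set.Icc xl xu := Set.Icc_subset_Icc_left hr1
  have hg : ContinuousOn (fun x => (r - x - ψ x) * f x) (Set.Icc r xu) :=
    ((continuousOn_const.sub continuousOn_id).sub (hψc.mono hsub)).mul (hf_cont.mono hsub)
  have hgi : ∀ x ∈ Set.Icc r xu, ∀ y ∈ Set.Icc r xu,
      IntervalIntegrable (fun x => (r - x - ψ x) * f x) MeasureTheory.volume x y :=
    fun x hx y hy => (hg.mono (Set.uIcc_subset_Icc hx hy)).intervalIntegrable
  have hfi : ∀ x ∈ Set.Icc xl xu, ∀ y ∈ Set.Icc xl xu,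
      IntervalIntegrable f MeasureTheory.volume x y :=
    fun x hx y hy => (hf_cont.mono (Set.uIcc_subset_Icc hx hy)).intervalIntegrable
  have hstrict : StrictMonoOn z (Set.Icc r ar) := by
    intro x hx y hy hxy
    have hrI : r ∈ Set.Icc r xu := ⟨le_rfl, hr2.le⟩
    have hxI : x ∈ Set.Icc r xu := ⟨hx.1, hx.2.trans har1⟩
    have hyI : y ∈ Set.Icc r xu := ⟨hy.1, hy.2.trans har1⟩
    have hpos : 0 < ∫ t in x..y, (r - t - ψ t) * f t := by
      refine intervalIntegral.intervalIntegral_pos_of_pos_on (hgi x hxI y hyI) (fun t ht => ?_) hxy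
      have htar : t < ar := ht.2.trans_le hy.2
      have htI : t ∈ Set.Icc xl xu := hsub ⟨hx.1.trans ht.1.le, htar.le.trans har1⟩
      have hψt := hψm htI (hsub ⟨har0.le, har1⟩) htar
      exact mul_pos (by linarith) (hf_pos t htI)
    rw [hz, hz, min_eq_left hx.2, min_eq_left hy.2,
      ← intervalIntegral.integral_add_adjacent_intervals (hgi r hrI x hxI) (hgi x hxI y hyI)]
    nlinarith [mul_pos hN1 hpos]
  have hconst : ∀ x ∈ Set.Icc ar xu, z x = z ar := by
    intro x hx
    rw [hz, hz, min_eq_right hx.1, min_self]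
  have hmin : ∀ x, z x = z (min x ar) := by
    intro x
    rw [hz, hz, min_assoc, min_self]
  have hmono : MonotoneOn z (Set.Icc r xu) := by
    intro x hx y hy hxy
    rw [hmin x, hmin y]
    exact hstrict.monotoneOn ⟨le_min hx.1 har0.le, min_le_right _ _⟩
      ⟨le_min hy.1 har0.le, min_le_right _ _⟩ (min_le_min_right _ hxy)
  have hzf : ∀ x ∈ Set.Icc r xu,
      IntervalIntegrable (fun t => z t * f t) MeasureTheory.volume x xu := by
    intro x hx
    have hu : Set.uIcc x xu ⊆ Set.Icc r xu := Set.uIcc_subset_Icc hx ⟨hr2.le, le_rfl⟩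
    exact (hmono.mono hu).intervalIntegrable.mul_continuousOn (hf_cont.mono (hu.trans hsub))
  have hZz : ∀ x ∈ Set.Icc r xu, Z x = -∫ t in x..xu, z t * f t := by
    intro x hx
    have hxuI : xu ∈ Set.Icc xl xu := ⟨hlt.le, le_rfl⟩
    have hxlI : xl ∈ Set.Icc xl xu := ⟨le_rfl, hlt.le⟩
    have hFx : 1 - F x = ∫ t in x..xu, f t := by
      rw [← hFxu, hF xu hxuI, hF x (hsub hx), ← intervalIntegral.integral_add_adjacent_intervals
        (hfi xl hxlI x (hsub hx)) (hfi x (hsub hx) xu hxuI)]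
      ring
    have hinner : ∀ t, ((N : ℝ) - 1) * ((∫ s in r..(min t ar), (ψ s + s - r) * f s) * f t)
        = -(z t * f t + r * F r * f t) := by
      intro t
      have hneg : ∫ s in r..(min t ar), (ψ s + s - r) * f s
          = -∫ s in r..(min t ar), (r - s - ψ s) * f s := by
        rw [← intervalIntegral.integral_neg]
        congr 1
        ext s
        ring
      rw [hneg, hz]
      ring
    rw [hZ, hFx, ← intervalIntegral.integral_const_mul ((N : ℝ) - 1)]
    simp only [hinner]
    rw [intervalIntegral.integral_neg, intervalIntegral.integral_add (hzf x hx)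
      ((hfi x (hsub hx) xu hxuI).const_mul _), intervalIntegral.integral_const_mul]
    ring
  have hZxu : Z xu = 0 := by
    rw [hZz xu ⟨hr2.le, le_rfl⟩, intervalIntegral.integral_same, neg_zero]
  have hquasi : QuasiconvexOn ℝ (Set.Icc r xu) Z :=
    quasiconvexOn_of_eq_neg_integral_monotoneOn hmono (fun x hx => (hf_pos x (hsub hx)).le)
      (hzf r ⟨le_rfl, hr2.le⟩) hZz
  refine ⟨hstrict, hconst, hZxu, hquasi, fun x hx => ?_⟩
  have hord := (hquasi (max (Z r) 0)).ordConnected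
  exact (hord.out ⟨⟨le_rfl, hr2.le⟩, le_max_left _ _⟩
    ⟨⟨hr2.le, le_rfl⟩, hZxu.le.trans (le_max_right _ _)⟩ hx).2
end

section
/- If Z^r(r) ≤ 0, then z^r(a(r)) ≥ 0. -/
/-- If `Z^r(r) ≤ 0`, then `z^r(a(r)) ≥ 0`. -/
theorem z_at_ar_nonneg_of_Z_r_nonpos
    (N : ℕ) (hN : 3 ≤ N)
    (xl xu : ℝ) (hxl : 0 ≤ xl) (hlt : xl < xu)
    (F f : ℝ → ℝ)
    (hf_cont : ContinuousOn f (Set.Icc xl xu))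
    (hf_pos : ∀ x ∈ Set.Icc xl xu, 0 < f x)
    (hF : ∀ x ∈ Set.Icc xl xu, F x = ∫ t in xl..x, f t)
    (hFxu : F xu = 1)
    (ψ : ℝ → ℝ)
    (hψ : ∀ x ∈ Set.Icc xl xu, ψ x = x - (1 - F x) / f x)
    (hψc : ContinuousOn ψ (Set.Icc xl xu))
    (hψm : StrictMonoOn ψ (Set.Icc xl xu))
    (hψxu : 0 ≤ ψ xu)
    (r : ℝ) (hr : r ∈ Set.Ico xl xu) (hψr : ψ r < 0)
    (ar : ℝ) (har : ar ∈ Set.Ioc r xu) (har2 : ar + ψ ar = r)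
    (Z z : ℝ → ℝ)
    (hZ : ∀ xs : ℝ, Z xs = r * F r * (1 - F xs)
      + ((N : ℝ) - 1) *
        ∫ x in xs..xu, (∫ x' in r..(min x ar), (ψ x' + x' - r) * f x') * f x)
    (hz : ∀ xs : ℝ, z xs = -(r * F r)
      + ((N : ℝ) - 1) * ∫ x' in r..(min xs ar), (r - x' - ψ x') * f x') :
    Z r ≤ 0 → 0 ≤ z ar := by
  intro hZr
  obtain ⟨hr1, hr2⟩ := hr
  obtain ⟨ha1, ha2⟩ := har
  set g : ℝ → ℝ := fun x => (ψ x + x - r) * f x with hg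
  have hgc : ContinuousOn g (Set.Icc xl xu) :=
    ((hψc.add continuousOn_id).sub continuousOn_const).mul hf_cont
  have hgi : ∀ a b, xl ≤ a → a ≤ b → b ≤ xu → IntervalIntegrable g MeasureTheory.volume a b :=
    fun a b h1 h2 h3 =>
      (hgc.mono (Set.Icc_subset_Icc h1 h3)).intervalIntegrable_of_Icc h2
  have hfi : ∀ a b, xl ≤ a → a ≤ b → b ≤ xu → IntervalIntegrable f MeasureTheory.volume a b :=
    fun a b h1 h2 h3 =>
      (hf_cont.mono (Set.Icc_subset_Icc h1 h3)).intervalIntegrable_of_Icc h2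
  set G : ℝ → ℝ := fun x => ∫ x' in r..(min x ar), g x' with hG
  have hmin : ∀ x ∈ Set.Icc r xu, G ar ≤ G x := by
    intro x hx
    have hm : r ≤ min x ar := le_min hx.1 ha1.le
    have hadd := intervalIntegral.integral_add_adjacent_intervals
      (hgi r (min x ar) hr1 hm ((min_le_right _ _).trans ha2))
      (hgi (min x ar) ar (hr1.trans hm) (min_le_right _ _) ha2)
    have hneg : 0 ≤ ∫ t in (min x ar)..ar, -g t := by
      refine intervalIntegral.integral_nonneg (min_le_right _ _) fun t ht => ?_
      have htI : t ∈ Set.Icc xl xu := ⟨hr1.trans (hm.trans ht.1), ht.2.trans ha2⟩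
      have hψt : ψ t ≤ ψ ar :=
        hψm.monotoneOn htI ⟨hr1.trans ha1.le, ha2⟩ ht.2
      have := mul_nonneg (by linarith [ht.2] : 0 ≤ -(ψ t + t - r)) (hf_pos t htI).le
      simp only [hg]
      linarith
    rw [intervalIntegral.integral_neg] at hneg
    simp only [hG, min_self]
    linarith
  have hGc : ContinuousOn G (Set.Icc r xu) := by
    have hprim : ContinuousOn (fun y => ∫ t in r..y, g t) (Set.Icc r xu) := by
      have h := intervalIntegral.continuousOn_primitive_interval'
        (hgi r xu hr1 hr2.le le_rfl) Set.left_mem_uIcc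
      rwa [Set.uIcc_of_le hr2.le] at h
    exact hprim.comp (continuous_id.min continuous_const).continuousOn
      fun x hx => ⟨le_min hx.1 ha1.le, (min_le_left _ _).trans hx.2⟩
  have hmass : ∫ t in r..xu, f t = 1 - F r := by
    have h := intervalIntegral.integral_add_adjacent_intervals
      (hfi xl r le_rfl hr1 hr2.le) (hfi r xu hr1 hr2.le le_rfl)
    rw [← hF r ⟨hr1, hr2.le⟩, ← hF xu ⟨hlt.le, le_rfl⟩, hFxu] at h
    linarith
  have hpos : 0 < 1 - F r := by
    rw [← hmass]
    exact intervalIntegral.intervalIntegral_pos_of_pos_on (hfi r xu hr1 hr2.le le_rfl)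
      (fun x hx => hf_pos x ⟨hr1.trans hx.1.le, hx.2.le⟩) hr2
  have hint : G ar * (1 - F r) ≤ ∫ x in r..xu, G x * f x := by
    rw [← hmass, ← intervalIntegral.integral_const_mul]
    refine intervalIntegral.integral_mono_on hr2.le
      ((hfi r xu hr1 hr2.le le_rfl).const_mul _)
      ((hGc.mul (hf_cont.mono (Set.Icc_subset_Icc hr1 le_rfl))).intervalIntegrable_of_Icc
        hr2.le) fun x hx => ?_
    exact mul_le_mul_of_nonneg_right (hmin x hx) (hf_pos x ⟨hr1.trans hx.1, hx.2⟩).le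
  have hN1 : (0 : ℝ) ≤ (N : ℝ) - 1 := by
    have : (3 : ℝ) ≤ N := by exact_mod_cast hN
    linarith
  have hzG : z ar = -(r * F r) - ((N : ℝ) - 1) * G ar := by
    have h : ∫ x' in r..(min ar ar), (r - x' - ψ x') * f x' = -G ar := by
      simp only [hG, ← intervalIntegral.integral_neg]
      congr 1
      funext t
      simp only [hg]
      ring
    rw [hz, h]
    ring
  have hZG : Z r = r * F r * (1 - F r) + ((N : ℝ) - 1) * ∫ x in r..xu, G x * f x := hZ r
  have hscaled := mul_le_mul_of_nonneg_left hint hN1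
  have hprod : 0 ≤ z ar * (1 - F r) := by
    rw [hzG]
    linarith
  exact nonneg_of_mul_nonneg_left hprod hpos
end

section
/- The value Z^r(r) is weakly decreasing in the number of bidders: writing Z^{r,N} for the function Z^r defined with parameter N, for all integers N, N′ with 3 ≤ N ≤ N′ one has Z^{r,N′}(r) ≤ Z^{r,N}(r). -/
/-- A function that is nonpositive on `[a, b]` has nonpositive integral over `[a, b]`. -/
theorem intervalIntegral.integral_nonpos_of_forall {g : ℝ → ℝ} {a b : ℝ} (hab : a ≤ b)
    (hg : ∀ x ∈ Set.Icc a b, g x ≤ 0) : ∫ x in a..b, g x ≤ 0 := by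
  have h : 0 ≤ ∫ x in a..b, -g x :=
    intervalIntegral.integral_nonneg hab fun x hx => neg_nonneg.mpr (hg x hx)
  rwa [intervalIntegral.integral_neg, neg_nonneg] at h

/-- The value `Z^{r,N}(r)` is weakly decreasing in the number of
bidders `N`: for integers `3 ≤ N ≤ N′` one has `Z^{r,N′}(r) ≤ Z^{r,N}(r)`. -/
theorem Z_r_antitone_in_N
    (xl xu : ℝ) (hxl : 0 ≤ xl) (hlt : xl < xu)
    (F f : ℝ → ℝ)
    (hf_cont : ContinuousOn f (Set.Icc xl xu))
    (hf_pos : ∀ x ∈ Set.Icc xl xu, 0 < f x)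
    (hF : ∀ x ∈ Set.Icc xl xu, F x = ∫ t in xl..x, f t)
    (hFxu : F xu = 1)
    (ψ : ℝ → ℝ)
    (hψ : ∀ x ∈ Set.Icc xl xu, ψ x = x - (1 - F x) / f x)
    (hψc : ContinuousOn ψ (Set.Icc xl xu))
    (hψm : StrictMonoOn ψ (Set.Icc xl xu))
    (hψxu : 0 ≤ ψ xu)
    (r : ℝ) (hr : r ∈ Set.Ico xl xu) (hψr : ψ r < 0)
    (ar : ℝ) (har : ar ∈ Set.Ioc r xu) (har2 : ar + ψ ar = r)
    (ZN : ℕ → ℝ → ℝ)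
    (hZN : ∀ N : ℕ, 3 ≤ N → ∀ xs : ℝ, ZN N xs = r * F r * (1 - F xs)
      + ((N : ℝ) - 1) *
        ∫ x in xs..xu, (∫ x' in r..(min x ar), (ψ x' + x' - r) * f x') * f x) :
    ∀ N N' : ℕ, 3 ≤ N → N ≤ N' → ZN N' r ≤ ZN N r := by
  intro N N' hN hNN'
  have hsum : ∀ x ∈ Set.Icc r ar, ψ x + x - r ≤ 0 := by
    intro x hx
    have hle : ψ x ≤ ψ ar := hψm.monotoneOn ⟨hr.1.trans hx.1, hx.2.trans har.2⟩
      ⟨hr.1.trans har.1.le, har.2⟩ hx.2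
    linarith [hx.2]
  have hinner : ∀ x, r ≤ x → ∫ x' in r..(min x ar), (ψ x' + x' - r) * f x' ≤ 0 := by
    intro x hx
    refine intervalIntegral.integral_nonpos_of_forall (le_min hx har.1.le) ?_
    intro y hy
    have hyar : y ≤ ar := hy.2.trans (min_le_right _ _)
    exact mul_nonpos_of_nonpos_of_nonneg (hsum y ⟨hy.1, hyar⟩)
      (hf_pos y ⟨hr.1.trans hy.1, hyar.trans har.2⟩).le
  have houter : ∫ x in r..xu, (∫ x' in r..(min x ar), (ψ x' + x' - r) * f x') * f x ≤ 0 := by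
    refine intervalIntegral.integral_nonpos_of_forall hr.2.le ?_
    intro x hx
    exact mul_nonpos_of_nonpos_of_nonneg (hinner x hx.1) (hf_pos x ⟨hr.1.trans hx.1, hx.2⟩).le
  rw [hZN N hN r, hZN N' (hN.trans hNN') r]
  have hcast : (N : ℝ) - 1 ≤ (N' : ℝ) - 1 := sub_le_sub_right (Nat.cast_le.mpr hNN') 1
  exact add_le_add_right (mul_le_mul_of_nonpos_right hcast houter) _
end

section
/- Suppose ψ(x̲) < 0. Then there exists ε > 0 such that for every r ∈ [x̲, x̲ + ε) one has ψ(r) < 0 and Z^r(r) < 0; in particular Z^{x̲}(x̲) < 0. -/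
/-- If `φ ≤ 0` on `[l, u]` and `φ ≤ -c` on `[m, b] ⊆ [l, u]`, then for a nonnegative weight `f` the
integral of `φ * f` over `[l, u]` is at most `-c` times the mass of `[m, b]`. -/
theorem integral_mul_le_neg_mul_integral {φ f : ℝ → ℝ} {l m b u c : ℝ}
    (hlm : l ≤ m) (hmb : m ≤ b) (hbu : b ≤ u)
    (hφ : ContinuousOn φ (Set.Icc l u)) (hf : ContinuousOn f (Set.Icc l u))
    (hf0 : ∀ x ∈ Set.Icc l u, 0 ≤ f x) (hφ0 : ∀ x ∈ Set.Icc l u, φ x ≤ 0)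
    (hφc : ∀ x ∈ Set.Icc m b, φ x ≤ -c) :
    ∫ x in l..u, φ x * f x ≤ -c * ∫ x in m..b, f x := by
  have hint : ∀ s t, l ≤ s → s ≤ t → t ≤ u →
      IntervalIntegrable (fun x => φ x * f x) MeasureTheory.volume s t := fun s t hs hst ht =>
    ((hφ.mul hf).mono (Set.Icc_subset_Icc hs ht)).intervalIntegrable_of_Icc hst
  have hnonpos : ∀ s t, l ≤ s → s ≤ t → t ≤ u → ∫ x in s..t, φ x * f x ≤ 0 := by
    intro s t hs hst ht
    have h := intervalIntegral.integral_mono_on hst (hint s t hs hst ht)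
      (intervalIntegrable_const (c := (0 : ℝ))) fun x hx =>
        mul_nonpos_of_nonpos_of_nonneg (hφ0 x ⟨hs.trans hx.1, hx.2.trans ht⟩)
          (hf0 x ⟨hs.trans hx.1, hx.2.trans ht⟩)
    simpa using h
  have hfi : IntervalIntegrable f MeasureTheory.volume m b :=
    (hf.mono (Set.Icc_subset_Icc hlm hbu)).intervalIntegrable_of_Icc hmb
  have hmid : ∫ x in m..b, φ x * f x ≤ -c * ∫ x in m..b, f x := by
    rw [← intervalIntegral.integral_const_mul]
    exact intervalIntegral.integral_mono_on hmb (hint m b hlm hmb hbu) (hfi.const_mul _)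
      fun x hx => mul_le_mul_of_nonneg_right (hφc x hx)
        (hf0 x ⟨hlm.trans hx.1, hx.2.trans hbu⟩)
  rw [← intervalIntegral.integral_add_adjacent_intervals (hint l m le_rfl hlm (hmb.trans hbu))
      (hint m u hlm (hmb.trans hbu) le_rfl),
    ← intervalIntegral.integral_add_adjacent_intervals (hint m b hlm hmb hbu)
      (hint b u (hlm.trans hmb) hbu le_rfl)]
  linarith [hnonpos l m le_rfl hlm (hmb.trans hbu), hnonpos b u (hlm.trans hmb) hbu le_rfl]

/-- The truncated double integral of `φ * f` against `f` is bounded above by minus the product of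
a lower bound for `-φ` on `[m, b]`, the mass of `[m, b]` and the mass of `[b, u]`. -/
theorem integral_truncated_integral_mul_le {φ f : ℝ → ℝ} {r m b a u η : ℝ}
    (hrm : r ≤ m) (hmb : m ≤ b) (hba : b ≤ a) (hau : a ≤ u)
    (hφ : ContinuousOn φ (Set.Icc r u)) (hf : ContinuousOn f (Set.Icc r u))
    (hf0 : ∀ x ∈ Set.Icc r u, 0 ≤ f x) (hφ0 : ∀ x ∈ Set.Icc r a, φ x ≤ 0)
    (hφη : ∀ x ∈ Set.Icc m b, φ x ≤ -η) :
    ∫ x in r..u, (∫ y in r..min x a, φ y * f y) * f x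
      ≤ -(η * ∫ x in m..b, f x) * ∫ x in b..u, f x := by
  have hra : r ≤ a := hrm.trans (hmb.trans hba)
  have hru : r ≤ u := hra.trans hau
  have hsub : ∀ x, Set.Icc r (min x a) ⊆ Set.Icc r u := fun x =>
    Set.Icc_subset_Icc le_rfl ((min_le_right _ _).trans hau)
  have hprim : ContinuousOn (fun t => ∫ y in r..t, φ y * f y) (Set.Icc r u) := by
    have h := intervalIntegral.continuousOn_primitive_interval' (μ := MeasureTheory.volume)
      ((hφ.mul hf).intervalIntegrable_of_Icc hru) Set.left_mem_uIcc
    rwa [Set.uIcc_of_le hru] at h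
  have hcont : ContinuousOn (fun x => ∫ y in r..min x a, φ y * f y) (Set.Icc r u) :=
    hprim.comp (continuous_id.min continuous_const).continuousOn fun x hx =>
      ⟨le_min hx.1 hra, (min_le_left _ _).trans hx.2⟩
  refine integral_mul_le_neg_mul_integral (hrm.trans hmb) (hba.trans hau) le_rfl hcont hf hf0 ?_ ?_
  · intro x hx
    have hrx : r ≤ min x a := le_min hx.1 hra
    have h := integral_mul_le_neg_mul_integral (c := 0) le_rfl le_rfl hrx
      (hφ.mono (hsub x)) (hf.mono (hsub x)) (fun y hy => hf0 y (hsub x hy))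
      (fun y hy => hφ0 y ⟨hy.1, hy.2.trans (min_le_right _ _)⟩)
      (fun y hy => by
        have := hφ0 y ⟨hy.1, hy.2.trans hra⟩
        simpa using this)
    simpa using h
  · intro x hx
    rw [← neg_mul]
    exact integral_mul_le_neg_mul_integral hrm hmb (le_min hx.1 hba)
      (hφ.mono (hsub x)) (hf.mono (hsub x)) (fun y hy => hf0 y (hsub x hy))
      (fun y hy => hφ0 y ⟨hy.1, hy.2.trans (min_le_right _ _)⟩) hφη


/-- Suppose `ψ(x̲) < 0`. Then there exists `ε > 0` such that for
every `r ∈ [x̲, x̲ + ε)` one has `ψ(r) < 0` and `Z^r(r) < 0`; in particular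
`Z^{x̲}(x̲) < 0`. -/
theorem Z_r_neg_for_small_r
    (N : ℕ) (hN : 3 ≤ N)
    (xl xu : ℝ) (hxl : 0 ≤ xl) (hlt : xl < xu)
    (F f : ℝ → ℝ)
    (hf_cont : ContinuousOn f (Set.Icc xl xu))
    (hf_pos : ∀ x ∈ Set.Icc xl xu, 0 < f x)
    (hF : ∀ x ∈ Set.Icc xl xu, F x = ∫ t in xl..x, f t)
    (hFxu : F xu = 1)
    (ψ : ℝ → ℝ)
    (hψ : ∀ x ∈ Set.Icc xl xu, ψ x = x - (1 - F x) / f x)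
    (hψc : ContinuousOn ψ (Set.Icc xl xu))
    (hψm : StrictMonoOn ψ (Set.Icc xl xu))
    (hψxu : 0 ≤ ψ xu)
    (a : ℝ → ℝ)
    (ha : ∀ r ∈ Set.Ico xl xu, ψ r < 0 →
      a r ∈ Set.Ioc r xu ∧ a r + ψ (a r) = r)
    (Z : ℝ → ℝ)
    (hZ : ∀ r ∈ Set.Ico xl xu, ψ r < 0 →
      Z r = r * F r * (1 - F r)
        + ((N : ℝ) - 1) *
          ∫ x in r..xu, (∫ x' in r..(min x (a r)), (ψ x' + x' - r) * f x') * f x) :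
    ψ xl < 0 →
      (∃ ε > 0, (∀ r : ℝ, xl ≤ r → r < xl + ε → ψ r < 0 ∧ Z r < 0))
      ∧ Z xl < 0 := by
  intro hneg
  have hint : ∀ s t, xl ≤ s → s ≤ t → t ≤ xu →
      IntervalIntegrable f MeasureTheory.volume s t := fun s t hs hst ht =>
    (hf_cont.mono (Set.Icc_subset_Icc hs ht)).intervalIntegrable_of_Icc hst
  have hmass : ∀ s t, xl ≤ s → s < t → t ≤ xu → 0 < ∫ x in s..t, f x := fun s t hs hst ht =>
    intervalIntegral.intervalIntegral_pos_of_pos_on (hint s t hs hst.le ht)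
      (fun x hx => hf_pos x ⟨hs.trans hx.1.le, hx.2.le.trans ht⟩) hst
  have hxl_mem : xl ∈ Set.Icc xl xu := ⟨le_rfl, hlt.le⟩
  -- Near `xl` the function `ψ x + x - xl` stays below `ψ xl / 2`.
  obtain ⟨δ, hδ, hδu, hψδ⟩ : ∃ δ > 0, xl + 2 * δ < xu ∧
      ∀ x ∈ Set.Icc xl (xl + 2 * δ), ψ x + x - xl ≤ -(-ψ xl / 2) := by
    have hc : ContinuousWithinAt (fun x => ψ x + x - xl) (Set.Icc xl xu) xl :=
      ((hψc xl hxl_mem).add continuousWithinAt_id).sub continuousWithinAt_const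
    obtain ⟨d, hd, h⟩ := Metric.continuousWithinAt_iff.1 hc (-ψ xl / 2) (by linarith)
    refine ⟨min (d / 4) ((xu - xl) / 4), lt_min (by linarith) (by linarith), ?_, ?_⟩
    · linarith [min_le_right (d / 4) ((xu - xl) / 4)]
    · intro x hx
      have h1 := min_le_right (d / 4) ((xu - xl) / 4)
      have h2 := min_le_left (d / 4) ((xu - xl) / 4)
      have h3 := h (x := x) ⟨hx.1, by linarith [hx.2]⟩ (by
        rw [Real.dist_eq, abs_of_nonneg (by linarith [hx.1])]
        linarith [hx.2])
      rw [Real.dist_eq] at h3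
      linarith [(abs_lt.1 h3).2]
  set m := xl + δ with hm
  set b := xl + 2 * δ with hb
  set η := -ψ xl / 2 with hη
  set K := (η * ∫ x in m..b, f x) * ∫ x in b..xu, f x with hK
  have hKpos : 0 < K :=
    mul_pos (mul_pos (by linarith) (hmass m b (by linarith) (by linarith) hδu.le))
      (hmass b xu (by linarith) hδu le_rfl)
  -- The first summand of `Z r` is small near `xl`, since `F xl = 0`.
  obtain ⟨d, hd, hFd⟩ : ∃ d > 0, ∀ r ∈ Set.Icc xl xu, r < xl + d → xu * F r < K := by
    have hFc : ContinuousOn (fun r => xu * ∫ t in xl..r, f t) (Set.Icc xl xu) := by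
      have h := intervalIntegral.continuousOn_primitive_interval'
        (hint xl xu le_rfl hlt.le le_rfl) Set.left_mem_uIcc
      rw [Set.uIcc_of_le hlt.le] at h
      exact continuousOn_const.mul h
    obtain ⟨d, hd, h⟩ := Metric.continuousWithinAt_iff.1 (hFc xl hxl_mem) K hKpos
    refine ⟨d, hd, fun r hr hrd => ?_⟩
    have h1 := h hr (by
      rw [Real.dist_eq, abs_of_nonneg (by linarith [hr.1])]
      linarith)
    rw [Real.dist_eq] at h1
    simp only [intervalIntegral.integral_same, mul_zero, sub_zero] at h1
    rw [hF r hr]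
    exact (abs_lt.1 h1).2
  have key : ∀ r, xl ≤ r → r < xl + min d δ → ψ r < 0 ∧ Z r < 0 := by
    intro r hr hrε
    have hrd : r < xl + d := hrε.trans_le (by linarith [min_le_left d δ])
    have hrm : r < m := hrε.trans_le (by linarith [min_le_right d δ])
    have hru : r < xu := by linarith
    have hr_mem : r ∈ Set.Icc xl xu := ⟨hr, hru.le⟩
    have hψr : ψ r < 0 := by linarith [hψδ r ⟨hr, by linarith⟩]
    refine ⟨hψr, ?_⟩
    obtain ⟨⟨har, hau⟩, hroot⟩ := ha r ⟨hr, hru⟩ hψr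
    have hba : b ≤ a r := by
      by_contra! hab
      linarith [hψδ (a r) ⟨by linarith, hab.le⟩]
    have hIcc : Set.Icc r xu ⊆ Set.Icc xl xu := Set.Icc_subset_Icc hr le_rfl
    have hbound := integral_truncated_integral_mul_le (φ := fun x => ψ x + x - r) (f := f)
      (η := η) hrm.le (by linarith : m ≤ b) hba hau
      (((hψc.mono hIcc).add continuousOn_id).sub continuousOn_const) (hf_cont.mono hIcc)
      (fun x hx => (hf_pos x (hIcc hx)).le)
      (fun x hx => by
        have := hψm.monotoneOn (hIcc ⟨hx.1, hx.2.trans hau⟩) (hIcc ⟨har.le, hau⟩) hx.2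
        linarith [hx.2])
      (fun x hx => by linarith [hψδ x ⟨by linarith [hx.1], hx.2⟩])
    rw [neg_mul, ← hK] at hbound
    have hF0 : 0 ≤ F r := by
      rw [hF r hr_mem]
      exact intervalIntegral.integral_nonneg hr fun x hx =>
        (hf_pos x ⟨hx.1, hx.2.trans hru.le⟩).le
    have hfirst : r * F r * (1 - F r) < K := by
      have h0 : 0 ≤ r * F r := mul_nonneg (hxl.trans hr) hF0
      have h1 : r * F r ≤ xu * F r := mul_le_mul_of_nonneg_right hru.le hF0
      nlinarith [hFd r hr_mem hrd, mul_nonneg h0 hF0]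
    have hN' : (3 : ℝ) ≤ N := by exact_mod_cast hN
    rw [hZ r ⟨hr, hru⟩ hψr]
    nlinarith
  have hε : 0 < min d δ := lt_min hd hδ
  exact ⟨⟨min d δ, hε, key⟩, (key xl le_rfl (by linarith)).2⟩
end

section
/- For every r₁ ∈ (0, √3/(√3 + 2)], with x̂ = (1 + 1/√3)·r₁ and ŷ = (1 + 2/√3)·r₁, the first seller's expected revenue in the partial-pooling equilibrium admits the closed form (ŷ³ − x̂³)·r₁ + ∫_{ŷ}^{1} [ (ŷ²/t²)·r₁ + ∫_{ŷ}^{t} (s²/t²) ds ]·3t² dt = 1/4 + r₁³·(6√3 + 10)/(3√3) − r₁⁴·(47√3 + 80)/(12√3). -/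
/-- The expected payment collected when the highest valuation exceeds the cutoff `y`, with
reserve price `r`. -/
lemma integral_expected_payment {y r : ℝ} (hy : 0 < y) (hy1 : y ≤ 1) :
    ∫ t in y..(1 : ℝ), ((y ^ 2 / t ^ 2) * r + ∫ s in y..t, s ^ 2 / t ^ 2) * (3 * t ^ 2)
      = (3 * y ^ 2 * r - y ^ 3) * (1 - y) + (1 - y ^ 4) / 4 := by
  have hcongr : ∀ t ∈ Set.uIcc y 1,
      ((y ^ 2 / t ^ 2) * r + ∫ s in y..t, s ^ 2 / t ^ 2) * (3 * t ^ 2)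
        = (3 * y ^ 2 * r - y ^ 3) + t ^ 3 := by
    intro t ht
    rw [Set.uIcc_of_le hy1] at ht
    have ht0 : t ≠ 0 := (hy.trans_le ht.1).ne'
    rw [intervalIntegral.integral_div, integral_pow]
    field_simp
    norm_num
    ring
  rw [intervalIntegral.integral_congr hcongr,
    intervalIntegral.integral_add (by simp) (by simp),
    intervalIntegral.integral_const, integral_pow]
  norm_num
  ring

/-- For every `r₁ ∈ (0, √3/(√3 + 2)]`, with
`x̂ = (1 + 1/√3)·r₁` and `ŷ = (1 + 2/√3)·r₁`, the first seller's expected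
revenue in the partial-pooling equilibrium admits the closed form
`(ŷ³ − x̂³)·r₁ + ∫_{ŷ}^{1} [ (ŷ²/t²)·r₁ + ∫_{ŷ}^{t} s²/t² ds ]·3t² dt
  = 1/4 + r₁³·(6√3 + 10)/(3√3) − r₁⁴·(47√3 + 80)/(12√3)`. -/
theorem partial_pooling_revenue_closed_form :
    ∀ r₁ : ℝ, 0 < r₁ → r₁ ≤ Real.sqrt 3 / (Real.sqrt 3 + 2) →
      let xh := (1 + 1 / Real.sqrt 3) * r₁
      let yh := (1 + 2 / Real.sqrt 3) * r₁
      (yh ^ 3 - xh ^ 3) * r₁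
          + (∫ t in yh..(1 : ℝ),
              ((yh ^ 2 / t ^ 2) * r₁ + ∫ s in yh..t, s ^ 2 / t ^ 2) * (3 * t ^ 2))
        = 1 / 4 + r₁ ^ 3 * ((6 * Real.sqrt 3 + 10) / (3 * Real.sqrt 3))
            - r₁ ^ 4 * ((47 * Real.sqrt 3 + 80) / (12 * Real.sqrt 3)) := by
  intro r hr hle xh yh
  have hy : 0 < yh := by positivity
  have h3 : 0 < Real.sqrt 3 := by positivity
  have hy1 : yh ≤ 1 := by
    have hyr : yh = (Real.sqrt 3 + 2) / Real.sqrt 3 * r := by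
      simp only [yh]
      field_simp
    rw [le_div_iff₀ (by positivity)] at hle
    rw [hyr, div_mul_eq_mul_div, div_le_one h3]
    linarith
  rw [integral_expected_payment hy hy1]
  simp only [xh, yh]
  have hsq : Real.sqrt 3 ^ 2 = 3 := Real.sq_sqrt (by norm_num)
  generalize Real.sqrt 3 = q at *
  have hinv : 1 / q = q / 3 := by
    field_simp
    linarith
  have hc : (6 * q + 10) / (3 * q) = 2 + 10 * q / 9 := by
    field_simp
    linear_combination (-30 : ℝ) * hsq
  have hd : (47 * q + 80) / (12 * q) = 47 / 12 + 20 * q / 9 := by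
    field_simp
    linear_combination (-240 : ℝ) * hsq
  have htwo : 2 / q = 2 * q / 3 := by
    rw [show 2 / q = 2 * (1 / q) by ring, hinv]
    ring
  have hq3 : q ^ 3 = 3 * q := by linear_combination q * hsq
  have hq4 : q ^ 4 = 9 := by linear_combination (q ^ 2 + 3) * hsq
  rw [hinv, htwo, hc, hd]
  ring_nf
  rw [hq4, hq3, hsq]
  ring
end

section
/- Define P(r) = 1/4 + a·r³ − b·r⁴ with a = (6√3 + 10)/(3√3) and b = (47√3 + 80)/(12√3), and let r* = 3a/(4b) = 3·(6√3 + 10)/(47√3 + 80). Then r* ∈ (0, √3/(√3 + 2)), and for every r ∈ [0, √3/(√3 + 2)] one has P(r) ≤ P(r*), with equality if and only if r = r*. -/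
/-- The gap between the value of a quartic `c + a x³ - b x⁴` at its critical point `s = 3a/(4b)`
and its value elsewhere. -/
theorem quartic_gap_eq {a b s : ℝ} (h : 3 * a = 4 * b * s) (c r : ℝ) :
    (c + a * s ^ 3 - b * s ^ 4) - (c + a * r ^ 3 - b * r ^ 4)
      = b / 3 * (r - s) ^ 2 * (2 * r ^ 2 + (r + s) ^ 2) := by
  linear_combination (s ^ 3 - r ^ 3) / 3 * h

/-- With `P(r) = 1/4 + a·r³ − b·r⁴`, `a = (6√3 + 10)/(3√3)`,
`b = (47√3 + 80)/(12√3)`, and `r* = 3a/(4b) = 3(6√3 + 10)/(47√3 + 80)`, one has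
`r* ∈ (0, √3/(√3 + 2))`, and for every `r ∈ [0, √3/(√3 + 2)]`,
`P(r) ≤ P(r*)` with equality iff `r = r*`. -/
theorem optimal_reserve_price_maximizes_revenue
    (a b rs : ℝ)
    (ha : a = (6 * Real.sqrt 3 + 10) / (3 * Real.sqrt 3))
    (hb : b = (47 * Real.sqrt 3 + 80) / (12 * Real.sqrt 3))
    (hrs : rs = 3 * a / (4 * b))
    (P : ℝ → ℝ)
    (hP : ∀ r : ℝ, P r = 1 / 4 + a * r ^ 3 - b * r ^ 4) :
    rs = 3 * (6 * Real.sqrt 3 + 10) / (47 * Real.sqrt 3 + 80)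
    ∧ rs ∈ Set.Ioo 0 (Real.sqrt 3 / (Real.sqrt 3 + 2))
    ∧ ∀ r ∈ Set.Icc (0 : ℝ) (Real.sqrt 3 / (Real.sqrt 3 + 2)),
        P r ≤ P rs ∧ (P r = P rs ↔ r = rs) := by
  have hs : 0 < Real.sqrt 3 := Real.sqrt_pos.2 (by norm_num)
  have hsq : Real.sqrt 3 ^ 2 = 3 := Real.sq_sqrt (by norm_num)
  have hb0 : 0 < b := by rw [hb]; positivity
  have hclosed : rs = 3 * (6 * Real.sqrt 3 + 10) / (47 * Real.sqrt 3 + 80) := by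
    rw [hrs, ha, hb]
    field_simp
    norm_num
  have hpos : 0 < rs := by rw [hclosed]; positivity
  have hcrit : 3 * a = 4 * b * rs := by
    rw [hrs]
    field_simp
  refine ⟨hclosed, ⟨hpos, ?_⟩, fun r _ => ?_⟩
  · rw [hclosed, div_lt_div_iff₀ (by positivity) (by positivity)]
    nlinarith
  · have hgap : P rs - P r = b / 3 * (r - rs) ^ 2 * (2 * r ^ 2 + (r + rs) ^ 2) := by
      rw [hP, hP]
      exact quartic_gap_eq hcrit _ r
    have hfactor : 0 < 2 * r ^ 2 + (r + rs) ^ 2 := by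
      rcases eq_or_ne r 0 with rfl | hr
      · simpa using pow_pos hpos 2
      · positivity
    refine ⟨sub_nonneg.1 (by rw [hgap]; positivity), fun h => ?_, fun h => by rw [h]⟩
    rw [h, sub_self, eq_comm] at hgap
    simpa [hb0.ne', hfactor.ne', sub_eq_zero] using hgap
end

section
/- The function H is nondecreasing on [0, x̄]. -/
theorem pow_add_mul_pow_mul_sub_le (k : ℕ) {x y : ℝ} (hx : 0 ≤ x) (hxy : x ≤ y) :
    x ^ (k + 1) + (k + 1) * x ^ k * (y - x) ≤ y ^ (k + 1) := by
  induction k with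
  | zero => simp
  | succ k ih =>
    have h1 := mul_le_mul_of_nonneg_left ih (hx.trans hxy)
    have h2 : 0 ≤ ((k : ℝ) + 1) * x ^ k * (y - x) ^ 2 := by positivity
    have h3 : y ^ (k + 1 + 1) = y * y ^ (k + 1) := by ring
    rw [h3]
    refine le_trans (le_of_sub_nonneg ?_) h1
    refine h2.trans_eq ?_
    push_cast
    ring

theorem pow_add_mul_one_sub_mul_pow_le (k : ℕ) {x y b c : ℝ} (hb : 0 ≤ b) (hbx : b ≤ x)
    (hxy : x ≤ y) (hy : y ≤ 1) (hbc : b ≤ c) :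
    x ^ (k + 1) + (k + 1) * (1 - x) * b ^ k ≤ y ^ (k + 1) + (k + 1) * (1 - y) * c ^ k := by
  have h1 := pow_add_mul_pow_mul_sub_le k (hb.trans hbx) hxy
  have h2 : ((k : ℝ) + 1) * (y - x) * b ^ k ≤ (k + 1) * (y - x) * x ^ k := by
    have : 0 ≤ y - x := sub_nonneg.2 hxy
    gcongr
  have h3 : ((k : ℝ) + 1) * (1 - y) * b ^ k ≤ (k + 1) * (1 - y) * c ^ k := by
    have : 0 ≤ 1 - y := sub_nonneg.2 hy
    gcongr
  linarith

theorem monotoneOn_of_eq_integral_of_pos {F f : ℝ → ℝ} {a b : ℝ}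
    (hf_cont : ContinuousOn f (Set.Icc a b)) (hf_pos : ∀ x ∈ Set.Icc a b, 0 < f x)
    (hF : ∀ x ∈ Set.Icc a b, F x = ∫ t in a..x, f t) : MonotoneOn F (Set.Icc a b) := by
  intro x hx y hy hxy
  have hint : ∀ u ∈ Set.Icc a b, ∀ v ∈ Set.Icc a b, u ≤ v →
      IntervalIntegrable f MeasureTheory.volume u v := fun u hu v hv huv =>
    (hf_cont.mono (Set.Icc_subset_Icc hu.1 hv.2)).intervalIntegrable_of_Icc huv
  have ha : a ∈ Set.Icc a b := ⟨le_rfl, hx.1.trans hx.2⟩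
  rw [hF x hx, hF y hy, ← intervalIntegral.integral_add_adjacent_intervals
    (hint a ha x hx hx.1) (hint x hx y hy hxy)]
  exact le_add_of_nonneg_right (intervalIntegral.integral_nonneg hxy fun t ht =>
    (hf_pos t ⟨hx.1.trans ht.1, ht.2.trans hy.2⟩).le)


/-- The payment-probability function `H` of the modified
pay-your-bid auction is nondecreasing on `[0, x̄]`. -/
theorem H_monotone
    (N : ℕ) (hN : 3 ≤ N)
    (xu : ℝ) (hxu : 0 < xu)
    (F f : ℝ → ℝ)
    (hf_cont : ContinuousOn f (Set.Icc 0 xu))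
    (hf_pos : ∀ x ∈ Set.Icc 0 xu, 0 < f x)
    (hF : ∀ x ∈ Set.Icc 0 xu, F x = ∫ t in (0 : ℝ)..x, f t)
    (hFxu : F xu = 1)
    (ψ : ℝ → ℝ)
    (hψ : ∀ x ∈ Set.Icc 0 xu, ψ x = x - (1 - F x) / f x)
    (hψc : ContinuousOn ψ (Set.Icc 0 xu))
    (hψm : StrictMonoOn ψ (Set.Icc 0 xu))
    (hψ0 : ψ 0 < 0) (hψxu : 0 < ψ xu)
    (xH : ℝ) (hxH : xH ∈ Set.Icc 0 xu) (hxH0 : ψ xH = 0)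
    (a0 : ℝ) (ha0 : a0 ∈ Set.Ioo 0 xu) (ha0' : a0 + ψ a0 = 0)
    (H : ℝ → ℝ)
    (hH1 : ∀ q ∈ Set.Icc 0 xu, q < a0 → H q = F q ^ (N - 1))
    (hH2 : ∀ q ∈ Set.Icc 0 xu, a0 ≤ q → q < xH →
      H q = F q ^ (N - 1) + ((N : ℝ) - 1) * (1 - F q) * F (q + ψ q) ^ (N - 2))
    (hH3 : ∀ q ∈ Set.Icc 0 xu, xH ≤ q →
      H q = F q ^ (N - 1) + ((N : ℝ) - 1) * (1 - F q) * F q ^ (N - 2)) :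
    MonotoneOn H (Set.Icc 0 xu) := by
  obtain ⟨k, rfl⟩ : ∃ k, N = k + 3 := ⟨N - 3, by omega⟩
  have hN1 : k + 3 - 1 = k + 1 + 1 := rfl
  have hN2 : k + 3 - 2 = k + 1 := rfl
  rw [hN1] at hH1 hH2 hH3
  rw [hN2] at hH2 hH3
  have hFm := monotoneOn_of_eq_integral_of_pos hf_cont hf_pos hF
  have h0 : (0 : ℝ) ∈ Set.Icc 0 xu := ⟨le_rfl, hxu.le⟩
  have hF0 : F 0 = 0 := by simp [hF 0 h0]
  have hFnn : ∀ x ∈ Set.Icc 0 xu, 0 ≤ F x := fun x hx => hF0 ▸ hFm h0 hx hx.1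
  have hF1 : ∀ x ∈ Set.Icc 0 xu, F x ≤ 1 := fun x hx => hFxu ▸ hFm hx ⟨hxu.le, le_rfl⟩ hx.2
  have haI : a0 ∈ Set.Icc 0 xu := Set.Ioo_subset_Icc_self ha0
  have haH : a0 < xH := (hψm.lt_iff_lt haI hxH).1 (by linarith [ha0.1])
  have hmid : ∀ q ∈ Set.Icc 0 xu, a0 ≤ q → q < xH →
      q + ψ q ∈ Set.Icc 0 xu ∧ q + ψ q ≤ q := fun q hq h1 h2 => by
    have h3 := hψm.monotoneOn haI hq h1
    have h4 := hψm hq hxH h2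
    exact ⟨⟨by linarith, by linarith [hq.2]⟩, by linarith⟩
  let b : ℝ → ℝ := fun q => if q < a0 then 0 else if q < xH then F (q + ψ q) else F q
  have hb : ∀ q ∈ Set.Icc 0 xu, 0 ≤ b q ∧ b q ≤ F q := fun q hq => by
    simp only [b]
    split_ifs with h1 h2
    · exact ⟨le_rfl, hFnn q hq⟩
    · obtain ⟨hm, hle⟩ := hmid q hq (not_lt.1 h1) h2
      exact ⟨hFnn _ hm, hFm hm hq hle⟩
    · exact ⟨hFnn q hq, le_rfl⟩
  have hbm : MonotoneOn b (Set.Icc 0 xu) := fun q hq r hr hqr => by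
    by_cases hqa : q < a0
    · simpa [b, hqa] using (hb r hr).1
    have hra : ¬ r < a0 := fun h => hqa (hqr.trans_lt h)
    by_cases hrH : r < xH
    · have hqH := hqr.trans_lt hrH
      simp only [b, hqa, hra, hqH, hrH, if_true, if_false]
      exact hFm (hmid q hq (not_lt.1 hqa) hqH).1 (hmid r hr (not_lt.1 hra) hrH).1
        (add_le_add hqr (hψm.monotoneOn hq hr hqr))
    · calc b q ≤ F q := (hb q hq).2
        _ ≤ F r := hFm hq hr hqr
        _ = b r := by simp [b, hra, hrH]
  have hHb : ∀ q ∈ Set.Icc 0 xu, H q =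
      F q ^ (k + 1 + 1) + (((k + 1 : ℕ) : ℝ) + 1) * (1 - F q) * b q ^ (k + 1) := fun q hq => by
    have hc : ((k + 3 : ℕ) : ℝ) - 1 = ((k + 1 : ℕ) : ℝ) + 1 := by push_cast; ring
    rw [← hc]
    by_cases h1 : q < a0
    · simp [b, h1, hH1 q hq h1]
    by_cases h2 : q < xH
    · simp only [b, h1, h2, if_true, if_false, hH2 q hq (not_lt.1 h1) h2]
    · simp only [b, h1, h2, if_false, hH3 q hq (not_lt.1 h2)]
  intro q hq r hr hqr
  rw [hHb q hq, hHb r hr]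
  exact pow_add_mul_one_sub_mul_pow_le (k + 1) (hb q hq).1 (hb q hq).2 (hFm hq hr hqr)
    (hF1 r hr) (hbm hq hr hqr)
end
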